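/- arXiv:2508.17360 — 3 statements merged into one kernel-verified Lean document; each statement's English description precedes it below -/
import Mathlib

section
/- Let m > 2 be an integer and let p_1, …, p_{m-1} ∈ (0,1) satisfy p_1 + ⋯ + p_{m-1} < 1; set p_m := 1 − (p_1 + ⋯ + p_{m-1}), and fix L > 0. For each N, let X^(N) be the length of a uniformly random stick after N stages of the fixed multi-proportion fragmentation, i.e. X^(N) = L·∏_{j=1}^{N} p_{w(j)} where w is chosen uniformly at random from the m^N functions w : {1,…,N} → {1,…,m}. Let y_i = log_{10}(p_i/p_{i+1}) for 1 ≤ i ≤ m−1. Then the sequence {X^(N)} converges to strong Benford's law base 10 if and only if y_i is irrational for some 1 ≤ i ≤ m−1. -/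
/-- The significand of a positive real `x` base 10: the unique `S ∈ [1,10)`
with `x = S * 10^k` for some integer `k`. -/
noncomputable def signif (x : ℝ) : ℝ := (10 : ℝ) ^ Int.fract (Real.logb 10 x)

/-- The sequence of stick lengths after `N` stages of fixed multi-proportion
fragmentation with proportions `q : Fin m → ℝ` and initial length `L`
(the random stick is indexed by a uniformly random word `w : Fin N → Fin m`,
with length `L * ∏ j, q (w j)`) converges to strong Benford's law base 10:
for every `s ∈ [1,10]`, the probability that the significand is at most `s`
tends to `log₁₀ s`. -/
def StrongBenfordSticks (m : ℕ) (q : Fin m → ℝ) (L : ℝ) : Prop :=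
  ∀ s ∈ Set.Icc (1 : ℝ) 10,
    Filter.Tendsto
      (fun N : ℕ =>
        (Nat.card {w : Fin N → Fin m | signif (L * ∏ j, q (w j)) ≤ s} : ℝ) / (m : ℝ) ^ N)
      Filter.atTop (nhds (Real.logb 10 s))

/-- The full proportion vector `(p₁, …, p_{m-1}, 1 - (p₁ + ⋯ + p_{m-1}))`,
where `m = n + 1`. -/
noncomputable def fullProp {n : ℕ} (p : Fin n → ℝ) : Fin (n + 1) → ℝ :=
  Fin.snoc p (1 - ∑ i, p i)

open MeasureTheory Filter Topology

lemma signif_le_iff {x s : ℝ} (hs : 0 < s) :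
    signif x ≤ s ↔ Int.fract (Real.logb 10 x) ≤ Real.logb 10 s := by
  rw [signif, Real.le_logb_iff_rpow_le (by norm_num) hs]

/-- Strong Benford behaviour of the sticks, expressed through the fractional parts of the
logarithms of their lengths. -/
lemma strongBenfordSticks_iff {m : ℕ} {q : Fin m → ℝ} (hq : ∀ i, 0 < q i) {L : ℝ} (hL : 0 < L) :
    StrongBenfordSticks m q L ↔ ∀ t ∈ Set.Icc (0 : ℝ) 1,
      Tendsto (fun N : ℕ =>
        (Nat.card {w : Fin N → Fin m |
          Int.fract (Real.logb 10 L + ∑ j, Real.logb 10 (q (w j))) ≤ t} : ℝ) / (m : ℝ) ^ N)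
        atTop (𝓝 t) := by
  have hlog : ∀ (N : ℕ) (w : Fin N → Fin m), Real.logb 10 (L * ∏ j, q (w j)) =
      Real.logb 10 L + ∑ j, Real.logb 10 (q (w j)) := fun N w => by
    rw [Real.logb_mul hL.ne' (Finset.prod_pos fun j _ => hq _).ne',
      Real.logb_prod _ _ fun j _ => (hq _).ne']
  constructor
  · intro h t ht
    have h1 : (1 : ℝ) ≤ 10 ^ t := Real.one_le_rpow (by norm_num) ht.1
    have h10 : (10 : ℝ) ^ t ≤ 10 := by
      simpa using Real.rpow_le_rpow_of_exponent_le (x := 10) (by norm_num) ht.2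
    have := h (10 ^ t) ⟨h1, h10⟩
    simpa only [signif_le_iff (zero_lt_one.trans_le h1), hlog,
      Real.logb_rpow (show (0 : ℝ) < 10 by norm_num) (by norm_num)] using this
  · intro h s hs
    have hs0 : 0 < s := zero_lt_one.trans_le hs.1
    simp only [signif_le_iff hs0, hlog]
    refine h _ ⟨Real.logb_nonneg (by norm_num) hs.1, ?_⟩
    rw [Real.logb_le_iff_le_rpow (by norm_num) hs0]
    simpa using hs.2

section Equidistribution

/-- The normalised Haar measure on the circle `ℝ / ℤ`. -/
noncomputable def unitCircleMeasure : ProbabilityMeasure UnitAddCircle :=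
  ⟨volume, ⟨UnitAddCircle.measure_univ⟩⟩

lemma integral_fourier_volume_eq_zero {k : ℤ} (hk : k ≠ 0) :
    ∫ x : UnitAddCircle, fourier k x = 0 := by
  have h := integral_add_right_eq_self (μ := (volume : Measure UnitAddCircle))
    (fun x => fourier k x) (((1 : ℝ) / 2 / k : ℝ) : UnitAddCircle)
  simp only [fourier_add_half_inv_index hk one_pos] at h
  rw [integral_neg] at h
  exact self_eq_neg.mp h.symm

/-- Weyl's criterion for weak convergence to the uniform distribution on the circle. -/
lemma tendsto_unitCircleMeasure {ι : Type*} {l : Filter ι}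
    {μ : ι → ProbabilityMeasure UnitAddCircle}
    (h : ∀ k : ℤ, k ≠ 0 → Tendsto (fun i => ∫ x, fourier k x ∂(μ i : Measure UnitAddCircle))
      l (𝓝 0)) :
    Tendsto μ l (𝓝 unitCircleMeasure) := by
  let e : BoundedContinuousFunction UnitAddCircle ℂ →⋆ₐ[ℂ] C(UnitAddCircle, ℂ) :=
    BoundedContinuousFunction.toContinuousMapStarₐ ℂ
  refine ProbabilityMeasure.tendsto_of_tight_of_separatesPoints ℂ .of_compactSpace
    (A := fourierSubalgebra.comap e) ?_ ?_
  · intro x y hxy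
    obtain ⟨_, ⟨f, hf, rfl⟩, hfxy⟩ := fourierSubalgebra_separatesPoints hxy
    refine ⟨_, ⟨f, ⟨BoundedContinuousFunction.mkOfCompact f, ?_, ?_⟩, rfl⟩, hfxy⟩
    · exact hf
    · rfl
  · intro g hg
    have hg' : (g : C(UnitAddCircle, ℂ)) ∈ Submodule.span ℂ (Set.range (@fourier 1)) := by
      rw [← fourierSubalgebra_coe]
      exact hg
    suffices H : ∀ f ∈ Submodule.span ℂ (Set.range (@fourier 1)),
        Tendsto (fun i => ∫ x, f x ∂(μ i : Measure UnitAddCircle)) l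
          (𝓝 (∫ x, f x ∂(unitCircleMeasure : Measure UnitAddCircle))) from H _ hg'
    have hint : ∀ (f : C(UnitAddCircle, ℂ)) (ν : ProbabilityMeasure UnitAddCircle),
        Integrable f (ν : Measure UnitAddCircle) := fun f ν =>
      f.continuous.integrable_of_hasCompactSupport (HasCompactSupport.of_compactSpace _)
    intro f hf
    induction hf using Submodule.span_induction with
    | mem f hf =>
      obtain ⟨k, rfl⟩ := hf
      rcases eq_or_ne k 0 with rfl | hk
      · simpa using tendsto_const_nhds
      · have h0 : ∫ x, fourier k x ∂(unitCircleMeasure : Measure UnitAddCircle) = 0 :=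
          integral_fourier_volume_eq_zero hk
        rw [h0]
        exact h k hk
    | zero => simpa using tendsto_const_nhds
    | add f g _ _ hf hg =>
      simp only [ContinuousMap.add_apply, integral_add (hint f _) (hint g _)]
      exact hf.add hg
    | smul c f _ hf =>
      simp only [ContinuousMap.smul_apply, integral_smul]
      exact hf.const_smul c

lemma coe_mem_closedBall_iff_fract_le {t x : ℝ} (ht : t < 1) :
    (x : UnitAddCircle) ∈ Metric.closedBall ((t / 2 : ℝ) : UnitAddCircle) (t / 2) ↔
      Int.fract x ≤ t := by
  rw [← Set.mem_preimage, AddCircle.coe_real_preimage_closedBall_eq_iUnion]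
  simp only [Set.mem_iUnion, Real.closedBall_eq_Icc, Set.mem_Icc, zsmul_eq_mul, mul_one]
  constructor
  · rintro ⟨z, h1, h2⟩
    have : ⌊x⌋ = z := Int.floor_eq_iff.2 ⟨by linarith, by linarith⟩
    rw [Int.fract, this]
    linarith
  · intro h
    have h0 := Int.fract_nonneg x
    rw [Int.fract] at h h0
    exact ⟨⌊x⌋, by linarith, by linarith⟩

lemma tendsto_measure_closedBall {ι : Type*} {l : Filter ι}
    {μ : ι → ProbabilityMeasure UnitAddCircle} (h : Tendsto μ l (𝓝 unitCircleMeasure))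
    {t : ℝ} (ht0 : 0 ≤ t) (ht : t < 1) (a : UnitAddCircle) :
    Tendsto (fun i => (μ i : Measure UnitAddCircle).real (Metric.closedBall a (t / 2)))
      l (𝓝 t) := by
  have hfr : (unitCircleMeasure : Measure UnitAddCircle)
      (frontier (Metric.closedBall a (t / 2))) = 0 := by
    refine measure_mono_null (t := Metric.closedBall a (t / 2) \ Metric.ball a (t / 2)) ?_
      (ae_le_set.1 (AddCircle.closedBall_ae_eq_ball (T := 1)).le)
    rw [Metric.isClosed_closedBall.frontier_eq]
    exact Set.sdiff_subset_sdiff_right Metric.ball_subset_interior_closedBall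
  have key := ProbabilityMeasure.tendsto_measure_of_null_frontier_of_tendsto' h hfr
  have hv : (unitCircleMeasure : Measure UnitAddCircle) (Metric.closedBall a (t / 2)) =
      ENNReal.ofReal t := by
    refine (AddCircle.volume_closedBall (T := 1) (x := a) (t / 2)).trans ?_
    rw [mul_div_cancel₀ t two_ne_zero, min_eq_right ht.le]
  rw [hv] at key
  have := (ENNReal.tendsto_toReal ENNReal.ofReal_ne_top).comp key
  rwa [ENNReal.toReal_ofReal ht0] at this

end Equidistribution

lemma norm_sum_lt_card {ι : Type*} [Fintype ι] {v : ι → ℂ} (hv : ∀ i, ‖v i‖ = 1)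
    {i j : ι} (hij : v i ≠ v j) : ‖∑ k, v k‖ < Fintype.card ι := by
  classical
  have hne : j ≠ i := fun h => hij (by rw [h])
  have hj : j ∈ Finset.univ.erase i := by simp [hne]
  rw [← Finset.add_sum_erase _ _ (Finset.mem_univ i), ← Finset.add_sum_erase _ _ hj, ← add_assoc]
  have h1 : ‖v i + v j‖ < 2 := by
    have := norm_add_lt_of_not_sameRay (x := v i) (y := v j)
      (by rwa [sameRay_iff_of_norm_eq (by rw [hv, hv])])
    rw [hv, hv] at this
    linarith
  have h2 : ‖∑ k ∈ (Finset.univ.erase i).erase j, v k‖ ≤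
      (((Finset.univ.erase i).erase j).card : ℝ) := by
    refine (norm_sum_le _ _).trans ?_
    simp [hv]
  have h3 : (((Finset.univ.erase i).erase j).card : ℝ) + 2 = Fintype.card ι := by
    have e1 := Finset.card_erase_add_one hj
    have e2 := Finset.card_erase_add_one (Finset.mem_univ i)
    rw [← Finset.card_univ]
    exact_mod_cast (by omega)
  calc _ ≤ _ := norm_add_le _ _
    _ < _ := by linarith

section Words

variable {m : ℕ}

/-- The distribution modulo one of `c + ∑ j, a (w j)` for a uniformly random word `w` of
length `N`. -/
noncomputable def wordMeasure (a : Fin m → ℝ) (c : ℝ) (N : ℕ) : Measure UnitAddCircle :=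
  (ProbabilityTheory.uniformOn (Set.univ : Set (Fin N → Fin m))).map
    fun w => ((c + ∑ j, a (w j) : ℝ) : UnitAddCircle)

instance [NeZero m] (a : Fin m → ℝ) (c : ℝ) (N : ℕ) : IsProbabilityMeasure (wordMeasure a c N) :=
  have := ProbabilityTheory.isProbabilityMeasure_uniformOn
    (Set.finite_univ (α := Fin N → Fin m)) Set.univ_nonempty
  Measure.isProbabilityMeasure_map (measurable_of_finite _).aemeasurable

lemma uniformOn_univ_real {Ω : Type*} [Fintype Ω] [MeasurableSpace Ω] [MeasurableSingletonClass Ω]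
    (s : Set Ω) : (ProbabilityTheory.uniformOn (Set.univ : Set Ω)).real s =
      (Nat.card s : ℝ) / Fintype.card Ω := by
  rw [measureReal_def, ProbabilityTheory.uniformOn_univ,
    Measure.count_apply_finite _ s.toFinite, ENNReal.toReal_div, ENNReal.toReal_natCast,
    ENNReal.toReal_natCast, Nat.card_coe_set_eq, Set.ncard_eq_toFinset_card _ s.toFinite]

lemma wordMeasure_real (a : Fin m → ℝ) (c : ℝ) (N : ℕ) {t : ℝ} (ht : t < 1) :
    (wordMeasure a c N).real (Metric.closedBall ((t / 2 : ℝ) : UnitAddCircle) (t / 2)) =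
      (Nat.card {w : Fin N → Fin m | Int.fract (c + ∑ j, a (w j)) ≤ t} : ℝ) / (m : ℝ) ^ N := by
  rw [wordMeasure, map_measureReal_apply (measurable_of_finite _) measurableSet_closedBall,
    uniformOn_univ_real]
  simp only [Set.preimage, coe_mem_closedBall_iff_fract_le ht]
  simp

lemma integral_fourier_wordMeasure [NeZero m] (a : Fin m → ℝ) (c : ℝ) (N : ℕ) (k : ℤ) :
    ∫ x, fourier k x ∂(wordMeasure a c N) =
      fourier k (c : UnitAddCircle) * ((∑ i, fourier k (a i : UnitAddCircle)) / m) ^ N := by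
  have := ProbabilityTheory.isProbabilityMeasure_uniformOn
    (Set.finite_univ (α := Fin N → Fin m)) Set.univ_nonempty
  rw [wordMeasure, integral_map (measurable_of_finite _).aemeasurable
    (fourier k).continuous.aestronglyMeasurable, integral_fintype .of_finite]
  have hw : ∀ w : Fin N → Fin m, fourier k ((c + ∑ j, a (w j) : ℝ) : UnitAddCircle) =
      fourier k (c : UnitAddCircle) * ∏ j, fourier k (a (w j) : UnitAddCircle) := fun w => by
    simp only [fourier_coe_apply, ← Complex.exp_sum, ← Complex.exp_add]
    push_cast
    rw [← Finset.sum_div, ← Finset.mul_sum]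
    ring_nf
  simp only [hw, uniformOn_univ_real]
  rw [div_pow, Fintype.sum_pow, Finset.sum_div, Finset.mul_sum]
  refine Finset.sum_congr rfl fun w _ => ?_
  simp only [Nat.card_unique, Fintype.card_fun, Fintype.card_fin, Complex.real_smul]
  push_cast
  ring

lemma tendsto_fract_words [NeZero m] {a : Fin m → ℝ} (c : ℝ) {i j : Fin m}
    (hij : Irrational (a i - a j)) {t : ℝ} (ht : t ∈ Set.Icc (0 : ℝ) 1) :
    Tendsto (fun N : ℕ =>
      (Nat.card {w : Fin N → Fin m | Int.fract (c + ∑ j, a (w j)) ≤ t} : ℝ) / (m : ℝ) ^ N)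
      atTop (𝓝 t) := by
  have hm : (0 : ℝ) < m := by exact_mod_cast Nat.pos_of_neZero m
  rcases ht.2.eq_or_lt with rfl | ht1
  · refine tendsto_const_nhds.congr fun N => ?_
    have : {w : Fin N → Fin m | Int.fract (c + ∑ j, a (w j)) ≤ 1} = Set.univ :=
      Set.eq_univ_of_forall fun w => Set.mem_ofPred.2 (Int.fract_lt_one _).le
    rw [this, Nat.card_coe_set_eq, Set.ncard_univ, Nat.card_eq_fintype_card, Fintype.card_fun,
      Fintype.card_fin, Fintype.card_fin, Nat.cast_pow, div_self (by positivity)]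
  let μ : ℕ → ProbabilityMeasure UnitAddCircle := fun N => ⟨wordMeasure a c N, inferInstance⟩
  have hμ : Tendsto μ atTop (𝓝 unitCircleMeasure) := by
    refine tendsto_unitCircleMeasure fun k hk => ?_
    have hne : fourier k (a i : UnitAddCircle) ≠ fourier k (a j : UnitAddCircle) := by
      intro h
      rw [fourier_apply, fourier_apply] at h
      have h' := AddCircle.injective_toCircle one_ne_zero (Subtype.ext h)
      rw [← sub_eq_zero, ← smul_sub, ← AddCircle.coe_sub, ← AddCircle.coe_zsmul,
        AddCircle.coe_eq_zero_iff] at h'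
      obtain ⟨z, hz⟩ := h'
      simp only [zsmul_eq_mul, mul_one] at hz
      exact (hij.intCast_mul hk).ne_int z hz.symm
    have hlt := norm_sum_lt_card (v := fun i => fourier k (a i : UnitAddCircle))
      (fun i => Circle.norm_coe _) hne
    rw [Fintype.card_fin] at hlt
    have : Tendsto (fun N : ℕ => fourier k (c : UnitAddCircle) *
        ((∑ i, fourier k (a i : UnitAddCircle)) / m) ^ N) atTop (𝓝 0) := by
      rw [← mul_zero (fourier k (c : UnitAddCircle))]
      refine (tendsto_pow_atTop_nhds_zero_of_norm_lt_one ?_).const_mul _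
      rwa [norm_div, Complex.norm_natCast, div_lt_one hm]
    refine this.congr fun N => ?_
    exact (integral_fourier_wordMeasure a c N k).symm
  exact (tendsto_measure_closedBall hμ ht.1 ht1 ((t / 2 : ℝ) : UnitAddCircle)).congr
    fun N => wordMeasure_real a c N ht1

lemma exists_fract_mem_Ioc {a : Fin m → ℝ} {c : ℝ}
    (h : ∀ t ∈ Set.Icc (0 : ℝ) 1, Tendsto (fun N : ℕ =>
      (Nat.card {w : Fin N → Fin m | Int.fract (c + ∑ j, a (w j)) ≤ t} : ℝ) / (m : ℝ) ^ N)
      atTop (𝓝 t))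
    {s t : ℝ} (hs : 0 ≤ s) (hst : s < t) (ht : t ≤ 1) :
    ∀ᶠ N : ℕ in atTop, ∃ w : Fin N → Fin m, Int.fract (c + ∑ j, a (w j)) ∈ Set.Ioc s t := by
  filter_upwards [(h s ⟨hs, hst.le.trans ht⟩).eventually_lt (h t ⟨hs.trans hst.le, ht⟩) hst]
    with N hN
  by_contra! hno
  refine hN.not_ge (div_le_div_of_nonneg_right ?_ (by positivity))
  refine Nat.cast_le.2 (Nat.card_mono (Set.toFinite _) fun w hw => ?_)
  by_contra hw'
  exact hno w ⟨not_le.1 hw', hw⟩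

lemma not_forall_tendsto_fract_words {a : Fin m → ℝ} (c : ℝ) {K : ℕ} (hK : 0 < K)
    (ha : ∀ i j, ∃ z : ℤ, K * (a i - a j) = z) :
    ¬ ∀ t ∈ Set.Icc (0 : ℝ) 1, Tendsto (fun N : ℕ =>
      (Nat.card {w : Fin N → Fin m | Int.fract (c + ∑ j, a (w j)) ≤ t} : ℝ) / (m : ℝ) ^ N)
      atTop (𝓝 t) := by
  intro h
  have hK' : (1 : ℝ) ≤ K := by exact_mod_cast hK
  have hinv : 1 / (K : ℝ) ≤ 1 := by rw [div_le_one (by linarith)]; exact hK'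
  have hinv0 : 0 < 1 / (K : ℝ) := by positivity
  obtain ⟨N, ⟨w, hw⟩, ⟨w', hw'⟩⟩ :=
    ((exists_fract_mem_Ioc h (s := 0) (t := 1 / K / 2) le_rfl (by positivity) (by linarith)).and
      (exists_fract_mem_Ioc h (s := 1 / K / 2) (t := 1 / K) (by positivity) (by linarith)
        hinv)).exists
  choose z hz using ha
  have hd : (K : ℝ) * (Int.fract (c + ∑ j, a (w' j)) - Int.fract (c + ∑ j, a (w j))) =
      ((∑ j, z (w' j) (w j) - K * (⌊c + ∑ j, a (w' j)⌋ - ⌊c + ∑ j, a (w j)⌋) : ℤ) : ℝ) := by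
    push_cast
    simp only [← hz, ← Finset.mul_sum, Finset.sum_sub_distrib, Int.fract]
    ring
  have h1 : (0 : ℝ) < K * (Int.fract (c + ∑ j, a (w' j)) - Int.fract (c + ∑ j, a (w j))) :=
    mul_pos (by linarith) (by linarith [hw.2, hw'.1])
  have h2 : K * (Int.fract (c + ∑ j, a (w' j)) - Int.fract (c + ∑ j, a (w j))) < 1 := by
    have : Int.fract (c + ∑ j, a (w' j)) - Int.fract (c + ∑ j, a (w j)) < 1 / K := by
      linarith [hw.1, hw'.2]
    rwa [lt_div_iff₀' (by linarith)] at this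
  rw [hd] at h1 h2
  exact (Int.cast_pos.1 h1).not_ge (Int.le_of_lt_add_one (by exact_mod_cast h2))

end Words

lemma exists_common_denominator {n : ℕ} {a : Fin (n + 1) → ℝ}
    (h : ∀ i : Fin n, ¬ Irrational (a i.castSucc - a i.succ)) :
    ∃ K : ℕ, 0 < K ∧ ∀ i j, ∃ z : ℤ, K * (a i - a j) = z := by
  simp only [Irrational, not_not] at h
  choose r hr using h
  refine ⟨∏ i, (r i).den, Finset.prod_pos fun i _ => (r i).den_pos, ?_⟩
  have hstep : ∀ i : Fin n, ∃ z : ℤ,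
      ((∏ i, (r i).den : ℕ) : ℝ) * (a i.castSucc - a i.succ) = z := by
    intro i
    obtain ⟨d, hd⟩ := Finset.dvd_prod_of_mem (fun i => (r i).den) (Finset.mem_univ i)
    refine ⟨d * (r i).num, ?_⟩
    have : ((r i).den : ℝ) * (r i : ℝ) = (r i).num := by
      exact_mod_cast Rat.den_mul_eq_num (r i)
    rw [hd, ← hr i]
    push_cast
    rw [← this]
    ring
  have hzero : ∀ i, ∃ z : ℤ, ((∏ i, (r i).den : ℕ) : ℝ) * (a 0 - a i) = z := by
    intro i
    induction i using Fin.induction with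
    | zero => exact ⟨0, by simp⟩
    | succ i ih =>
      obtain ⟨z, hz⟩ := ih
      obtain ⟨z', hz'⟩ := hstep i
      exact ⟨z + z', by rw [Int.cast_add, ← hz, ← hz']; ring⟩
  intro i j
  obtain ⟨z, hz⟩ := hzero i
  obtain ⟨z', hz'⟩ := hzero j
  exact ⟨z' - z, by rw [Int.cast_sub, ← hz, ← hz']; ring⟩

lemma fullProp_pos {n : ℕ} {p : Fin n → ℝ} (hp : ∀ i, 0 < p i) (hsum : ∑ i, p i < 1)
    (i : Fin (n + 1)) : 0 < fullProp p i := by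
  refine Fin.lastCases ?_ (fun i => ?_) i
  · simpa [fullProp] using hsum
  · simpa [fullProp] using hp i

/-- Fixed multi-proportion stick fragmentation: with `m = n + 1 > 2` proportions
(the first `n` given, each in `(0,1)` with sum `< 1`, the last defined as the
complement) and initial length `L > 0`, the lengths of the sticks converge to
strong Benford's law base 10 if and only if `yᵢ = log₁₀ (pᵢ / pᵢ₊₁)` is
irrational for some `1 ≤ i ≤ m - 1`. -/
theorem multiProportion_strongBenford_iff (n : ℕ) (hn : 2 ≤ n)
    (p : Fin n → ℝ) (hp : ∀ i, p i ∈ Set.Ioo (0 : ℝ) 1)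
    (hsum : ∑ i, p i < 1) (L : ℝ) (hL : 0 < L) :
    StrongBenfordSticks (n + 1) (fullProp p) L ↔
      ∃ i : Fin n,
        Irrational (Real.logb 10 (fullProp p i.castSucc / fullProp p i.succ)) := by
  have hq := fullProp_pos (fun i => (hp i).1) hsum
  rw [strongBenfordSticks_iff hq hL]
  have hlog : ∀ i : Fin n, Real.logb 10 (fullProp p i.castSucc / fullProp p i.succ) =
      Real.logb 10 (fullProp p i.castSucc) - Real.logb 10 (fullProp p i.succ) := fun i =>
    Real.logb_div (hq _).ne' (hq _).ne'
  simp only [hlog]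
  constructor
  · intro h
    by_contra! hno
    obtain ⟨K, hK, hz⟩ :=
      exists_common_denominator (a := fun i => Real.logb 10 (fullProp p i)) hno
    exact not_forall_tendsto_fract_words _ hK hz h
  · rintro ⟨i, hi⟩ t ht
    exact tendsto_fract_words (a := fun i => Real.logb 10 (fullProp p i)) _ hi ht
end

section
/- Fixed single proportion stick fragmentation theorem (m = 2): let p ∈ (0,1) and L > 0, and for each N let X^(N) = L·p^{k}·(1−p)^{N−k} where k is the number of indices j with w(j) = 1 for a uniformly random w : {1,…,N} → {1,2} (equivalently, the length of a uniformly random stick after N stages of splitting every stick at the fixed proportion p). Let y satisfy 10^y = (1−p)/p. Then {X^(N)} converges to strong Benford's law base 10 if and only if y is irrational. -/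
open MeasureTheory Filter Topology

section Weyl

variable {T : ℝ} [Fact (0 < T)]

/-- **Weyl's criterion** for the weak convergence of probability measures on a circle. -/
lemma AddCircle.tendsto_probabilityMeasure_of_fourier {ι : Type*} {l : Filter ι}
    {μs : ι → ProbabilityMeasure (AddCircle T)} {μ : ProbabilityMeasure (AddCircle T)}
    (h : ∀ n : ℤ, Tendsto (fun i => ∫ x, fourier n x ∂(μs i : Measure (AddCircle T))) l
      (𝓝 (∫ x, fourier n x ∂(μ : Measure (AddCircle T))))) :
    Tendsto μs l (𝓝 μ) := by
  have integrable_coe (f : C(AddCircle T, ℂ)) (ν : ProbabilityMeasure (AddCircle T)) :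
      Integrable f (ν : Measure (AddCircle T)) :=
    (BoundedContinuousFunction.mkOfCompact f).integrable _
  have span_case (g : C(AddCircle T, ℂ))
      (hg : g ∈ Submodule.span ℂ (Set.range (fourier (T := T)))) :
      Tendsto (fun i => ∫ x, g x ∂(μs i : Measure (AddCircle T))) l
        (𝓝 (∫ x, g x ∂(μ : Measure (AddCircle T)))) := by
    induction hg using Submodule.span_induction with
    | mem g hg => obtain ⟨n, rfl⟩ := hg; exact h n
    | zero => simpa using tendsto_const_nhds
    | add f g _ _ hf hg =>
      simp only [ContinuousMap.add_apply]
      simp_rw [fun ν => integral_add (integrable_coe f ν) (integrable_coe g ν)]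
      exact hf.add hg
    | smul c f _ hf =>
      simp only [ContinuousMap.smul_apply, integral_smul]
      exact hf.const_smul c
  rw [ProbabilityMeasure.tendsto_iff_forall_integral_rclike_tendsto ℂ]
  intro f
  rw [Metric.tendsto_nhds]
  intro ε hε
  have f_mem : f.toContinuousMap ∈
      (Submodule.span ℂ (Set.range (fourier (T := T)))).topologicalClosure := by
    rw [span_fourier_closure_eq_top]; trivial
  obtain ⟨g, hg, hfg⟩ := Metric.mem_closure_iff.1 f_mem (ε / 3) (by positivity)
  have close (ν : ProbabilityMeasure (AddCircle T)) :
      dist (∫ x, f x ∂(ν : Measure (AddCircle T))) (∫ x, g x ∂(ν : Measure (AddCircle T)))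
        ≤ ε / 3 := by
    rw [dist_eq_norm, ← integral_sub (f.integrable _) (integrable_coe g ν)]
    refine (norm_integral_le_of_norm_le_const (C := ε / 3) (.of_forall fun x => ?_)).trans
      (by simp)
    rw [← dist_eq_norm]
    exact (ContinuousMap.dist_apply_le_dist (f := f.toContinuousMap) (g := g) x).trans hfg.le
  filter_upwards [Metric.tendsto_nhds.1 (span_case g hg) (ε / 3) (by positivity)] with i hi
  have h₁ := close (μs i)
  have h₂ := close μ
  rw [dist_comm] at h₂
  linarith [dist_triangle4 (∫ x, f x ∂(μs i : Measure (AddCircle T)))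
    (∫ x, g x ∂(μs i : Measure (AddCircle T))) (∫ x, g x ∂(μ : Measure (AddCircle T)))
    (∫ x, f x ∂(μ : Measure (AddCircle T)))]

end Weyl

/-- The arc of the unit circle starting at `0` and of length `t`. -/
def UnitAddCircle.arc (t : ℝ) : Set UnitAddCircle :=
  (fun x : ℝ => (x : UnitAddCircle)) '' Set.Icc 0 t

namespace UnitAddCircle

instance isProbabilityMeasure_volume : IsProbabilityMeasure (volume : Measure UnitAddCircle) :=
  ⟨UnitAddCircle.measure_univ⟩

lemma coe_eq_coe_iff {x z : ℝ} : (x : UnitAddCircle) = z ↔ ∃ n : ℤ, x = z + n := by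
  rw [← sub_eq_zero, ← AddCircle.coe_sub, AddCircle.coe_eq_zero_iff]
  simp only [zsmul_eq_mul, mul_one]
  exact exists_congr fun n => ⟨fun h => by linarith, fun h => by linarith⟩

lemma coe_mem_arc {t : ℝ} (ht₀ : 0 ≤ t) (ht₁ : t ≤ 1) {x : ℝ} :
    (x : UnitAddCircle) ∈ arc t ↔ Int.fract x ≤ t := by
  constructor
  · rintro ⟨z, ⟨hz₀, hzt⟩, hzx⟩
    obtain ⟨n, rfl⟩ := coe_eq_coe_iff.1 hzx.symm
    rw [Int.fract_add_intCast]
    rcases lt_or_eq_of_le (hzt.trans ht₁) with hz | rfl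
    · rwa [Int.fract_eq_self.2 ⟨hz₀, hz⟩]
    · simpa using ht₀
  · intro h
    refine ⟨Int.fract x, ⟨Int.fract_nonneg x, h⟩, ?_⟩
    exact coe_eq_coe_iff.2 ⟨-⌊x⌋, by push_cast; rw [← Int.self_sub_floor]; ring⟩

lemma isClosed_arc (t : ℝ) : IsClosed (arc t) :=
  (isCompact_Icc.image (AddCircle.continuous_mk' 1)).isClosed

lemma frontier_arc_subset (t : ℝ) : frontier (arc t) ⊆ {0, (t : UnitAddCircle)} := by
  have interior_sub : (fun x : ℝ => (x : UnitAddCircle)) '' Set.Ioo 0 t ⊆ interior (arc t) :=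
    interior_maximal (Set.image_mono Set.Ioo_subset_Icc_self)
      (QuotientAddGroup.isOpenMap_coe _ isOpen_Ioo)
  rw [(isClosed_arc t).frontier_eq]
  rintro _ ⟨⟨x, hx, rfl⟩, hxi⟩
  rcases hx.1.eq_or_lt with rfl | h₀
  · left; simp
  rcases hx.2.eq_or_lt with rfl | h₁
  · right; rfl
  exact absurd (interior_sub ⟨x, ⟨h₀, h₁⟩, rfl⟩) hxi

lemma volume_singleton (x : UnitAddCircle) : volume ({x} : Set UnitAddCircle) = 0 := by
  simpa using AddCircle.volume_closedBall (T := 1) (x := x) 0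

lemma volume_frontier_arc (t : ℝ) : volume (frontier (arc t)) = 0 := by
  refine measure_mono_null (frontier_arc_subset t) ?_
  rw [← Set.singleton_union]
  exact measure_union_null (volume_singleton _) (volume_singleton _)

lemma volume_arc {t : ℝ} (ht₀ : 0 ≤ t) (ht₁ : t ≤ 1) : volume (arc t) = ENNReal.ofReal t := by
  rw [← (UnitAddCircle.measurePreserving_mk 0).measure_preimage
    (isClosed_arc t).measurableSet.nullMeasurableSet,
    Measure.restrict_congr_set Ioo_ae_eq_Ioc.symm,
    Measure.restrict_apply ((isClosed_arc t).measurableSet.preimage (AddCircle.measurable_mk'))]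
  have inter_eq : (QuotientAddGroup.mk ⁻¹' arc t : Set ℝ) ∩ Set.Ioo 0 (0 + 1)
      = Set.Ioc 0 t \ {1} := by
    ext x
    simp only [Set.mem_inter_iff, Set.mem_preimage, Set.mem_Ioo, Set.mem_Ioc, Set.mem_sdiff,
      Set.mem_singleton_iff, zero_add]
    rw [coe_mem_arc ht₀ ht₁]
    constructor
    · rintro ⟨h, h₀, h₁⟩
      rw [Int.fract_eq_self.2 ⟨h₀.le, h₁⟩] at h
      exact ⟨⟨h₀, h⟩, h₁.ne⟩
    · rintro ⟨⟨h₀, h⟩, hne⟩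
      have h₁ : x < 1 := lt_of_le_of_ne (h.trans ht₁) hne
      rw [Int.fract_eq_self.2 ⟨h₀.le, h₁⟩]
      exact ⟨h, h₀, h₁⟩
  rw [inter_eq, measure_sdiff_null (by simp)]
  simp

end UnitAddCircle

/-- The law of `c + ∑ j, b (w j)` modulo `1` for a uniformly random word `w : Fin N → Fin 2`. -/
noncomputable def wordLaw (b : Fin 2 → ℝ) (c : ℝ) (N : ℕ) : Measure UnitAddCircle :=
  ((2 : ENNReal) ^ N)⁻¹ •
    ∑ w : Fin N → Fin 2, Measure.dirac ((c + ∑ j, b (w j) : ℝ) : UnitAddCircle)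

instance wordLaw.isProbabilityMeasure (b : Fin 2 → ℝ) (c : ℝ) (N : ℕ) :
    IsProbabilityMeasure (wordLaw b c N) := by
  constructor
  simp only [wordLaw, Measure.smul_apply, Measure.finsetSum_apply, measure_univ, smul_eq_mul]
  simp only [Finset.sum_const, Finset.card_univ, Fintype.card_fun, Fintype.card_fin, nsmul_eq_mul,
    mul_one, Nat.cast_pow, Nat.cast_ofNat]
  exact ENNReal.inv_mul_cancel (by simp) (by simp)

lemma fourier_sum {ι : Type*} (n : ℤ) (s : Finset ι) (f : ι → ℝ) :
    fourier n ((∑ i ∈ s, f i : ℝ) : UnitAddCircle)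
      = ∏ i ∈ s, fourier n (f i : UnitAddCircle) := by
  simp only [fourier_coe_apply, ← Complex.exp_sum]
  simp [Finset.mul_sum]

lemma integral_fourier_wordLaw (b : Fin 2 → ℝ) (c : ℝ) (N : ℕ) (n : ℤ) :
    ∫ x, fourier n x ∂wordLaw b c N
      = fourier n (c : UnitAddCircle) * ((∑ i, fourier n (b i : UnitAddCircle)) / 2) ^ N := by
  rw [wordLaw, integral_smul_measure, integral_finsetSum_measure
    (fun w _ => integrable_dirac (by simp))]
  simp only [integral_dirac, AddCircle.coe_add, fourier_apply, smul_add, AddCircle.toCircle_add,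
    Circle.coe_mul]
  simp only [← fourier_apply, fourier_sum, ← Finset.mul_sum]
  rw [← Fintype.sum_pow (fun i => (fourier n (b i : UnitAddCircle)))]
  simp [div_pow, Fin.sum_univ_two]
  ring

lemma norm_fourier_add_lt {n : ℤ} (hn : n ≠ 0) {x z : ℝ} (h : Irrational (z - x)) :
    ‖fourier n (x : UnitAddCircle) + fourier n (z : UnitAddCircle)‖ < 2 := by
  have norm_one (u : ℝ) : ‖fourier n (u : UnitAddCircle)‖ = 1 := by
    rw [fourier_apply, Circle.norm_coe]
  have ne : fourier n (x : UnitAddCircle) ≠ fourier n (z : UnitAddCircle) := by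
    intro heq
    simp only [fourier_apply] at heq
    have heq' := AddCircle.injective_toCircle one_ne_zero (Circle.ext heq)
    rw [← AddCircle.coe_zsmul, ← AddCircle.coe_zsmul, UnitAddCircle.coe_eq_coe_iff] at heq'
    obtain ⟨m, hm⟩ := heq'
    refine (h.intCast_mul hn).ne_int (-m) ?_
    simp only [zsmul_eq_mul] at hm
    push_cast
    linarith
  have hlt := norm_add_lt_of_not_sameRay
    (mt (sameRay_iff_of_norm_eq ((norm_one x).trans (norm_one z).symm)).1 ne)
  rw [norm_one, norm_one] at hlt
  linarith

lemma integral_fourier_volume {n : ℤ} (hn : n ≠ 0) :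
    ∫ x : UnitAddCircle, fourier n x = 0 :=
  integral_eq_zero_of_add_right_eq_neg (fourier_add_half_inv_index hn one_pos)

lemma tendsto_wordLaw {b : Fin 2 → ℝ} (hb : Irrational (b 1 - b 0)) (c : ℝ) :
    Tendsto (β := ProbabilityMeasure UnitAddCircle) (fun N => ⟨wordLaw b c N, inferInstance⟩) atTop
      (𝓝 ⟨volume, inferInstance⟩) := by
  refine AddCircle.tendsto_probabilityMeasure_of_fourier fun n => ?_
  simp only [ProbabilityMeasure.coe_mk]
  rcases eq_or_ne n 0 with rfl | hn
  · simp
  simp only [integral_fourier_wordLaw, integral_fourier_volume hn]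
  have hlt : ‖(∑ i, fourier n (b i : UnitAddCircle)) / 2‖ < 1 := by
    rw [Fin.sum_univ_two, norm_div, div_lt_one (by simp)]
    simpa using norm_fourier_add_lt hn hb
  simpa using (tendsto_pow_atTop_nhds_zero_of_norm_lt_one hlt).const_mul
    (fourier n (c : UnitAddCircle))

lemma wordLaw_arc (b : Fin 2 → ℝ) (c : ℝ) (N : ℕ) {t : ℝ} (ht₀ : 0 ≤ t) (ht₁ : t ≤ 1) :
    wordLaw b c N (UnitAddCircle.arc t) = ENNReal.ofReal
      ((Nat.card {w : Fin N → Fin 2 | Int.fract (c + ∑ j, b (w j)) ≤ t} : ℝ) / 2 ^ N) := by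
  classical
  simp only [wordLaw, Measure.smul_apply, Measure.finsetSum_apply, smul_eq_mul,
    Measure.dirac_apply' _ (UnitAddCircle.isClosed_arc t).measurableSet, Set.indicator_apply,
    UnitAddCircle.coe_mem_arc ht₀ ht₁, Pi.one_apply, Finset.sum_boole]
  rw [ENNReal.ofReal_div_of_pos (by positivity), ENNReal.div_eq_inv_mul, ENNReal.ofReal_natCast,
    ENNReal.ofReal_pow (by simp), Nat.card_eq_fintype_card, ← Set.toFinset_card, Set.toFinset_ofPred]
  simp

lemma tendsto_card_fract_le {b : Fin 2 → ℝ} (hb : Irrational (b 1 - b 0)) (c : ℝ) {t : ℝ}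
    (ht₀ : 0 ≤ t) (ht₁ : t ≤ 1) :
    Tendsto (fun N : ℕ =>
        (Nat.card {w : Fin N → Fin 2 | Int.fract (c + ∑ j, b (w j)) ≤ t} : ℝ) / 2 ^ N)
      atTop (𝓝 t) := by
  have lim := ProbabilityMeasure.tendsto_measure_of_null_frontier_of_tendsto' (tendsto_wordLaw hb c)
    (E := UnitAddCircle.arc t) (UnitAddCircle.volume_frontier_arc t)
  simp only [ProbabilityMeasure.coe_mk, wordLaw_arc b c _ ht₀ ht₁,
    UnitAddCircle.volume_arc ht₀ ht₁] at lim
  have lim' := (ENNReal.tendsto_toReal ENNReal.ofReal_ne_top).comp lim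
  rw [ENNReal.toReal_ofReal ht₀] at lim'
  refine lim'.congr fun N => ?_
  exact ENNReal.toReal_ofReal (by positivity)

lemma logb_mul_prod {ι : Type*} [Fintype ι] {L : ℝ} (hL : L ≠ 0) {f : ι → ℝ} (hf : ∀ i, f i ≠ 0) :
    Real.logb 10 (L * ∏ i, f i) = Real.logb 10 L + ∑ i, Real.logb 10 (f i) := by
  rw [Real.logb_mul hL (Finset.prod_ne_zero_iff.2 fun i _ => hf i),
    Real.logb_prod _ _ fun i _ => hf i]

/-- If the fractional parts have asymptotic density `t` below each level `t`, every interval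
`(t, u]` is eventually hit. -/
lemma eventually_exists_fract_mem_Ioc {m : ℕ} {x : ∀ N : ℕ, (Fin N → Fin m) → ℝ}
    (h : ∀ t ∈ Set.Icc (0 : ℝ) 1, Tendsto (fun N : ℕ =>
        (Nat.card {w : Fin N → Fin m | Int.fract (x N w) ≤ t} : ℝ) / (m : ℝ) ^ N) atTop (𝓝 t))
    {t u : ℝ} (ht : 0 ≤ t) (htu : t < u) (hu : u ≤ 1) :
    ∀ᶠ N in atTop, ∃ w, Int.fract (x N w) ∈ Set.Ioc t u := by
  filter_upwards [(h t ⟨ht, htu.le.trans hu⟩).eventually_lt (h u ⟨ht.trans htu.le, hu⟩) htu]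
    with N hN
  by_contra! hcon
  refine hN.not_ge ?_
  gcongr
  refine Nat.card_mono (Set.toFinite _) fun w hw => ?_
  by_contra hw'
  exact hcon w ⟨not_le.1 hw', hw⟩

lemma sum_eq_mul_add_card_mul {N : ℕ} (b : Fin 2 → ℝ) (w : Fin N → Fin 2) :
    ∑ j, b (w j) = N * b 0 + (∑ j, (w j : ℕ) : ℕ) * (b 1 - b 0) := by
  have term (i : Fin 2) : b i = b 0 + (i : ℕ) * (b 1 - b 0) := by
    fin_cases i <;> simp
  rw [Finset.sum_congr rfl fun j _ => term (w j), Finset.sum_add_distrib, ← Finset.sum_mul]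
  simp

lemma irrational_of_tendsto_card_fract_le {b : Fin 2 → ℝ} {c : ℝ}
    (h : ∀ t ∈ Set.Icc (0 : ℝ) 1, Tendsto (fun N : ℕ =>
        (Nat.card {w : Fin N → Fin 2 | Int.fract (c + ∑ j, b (w j)) ≤ t} : ℝ) / ((2 : ℕ) : ℝ) ^ N)
      atTop (𝓝 t)) :
    Irrational (b 1 - b 0) := by
  rintro ⟨r, hr⟩
  have den_pos : (0 : ℝ) < r.den := by exact_mod_cast r.den_pos
  have one_le_den : (1 : ℝ) ≤ r.den := by exact_mod_cast r.den_pos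
  have hmul : (r.den : ℝ) * (b 1 - b 0) = r.num := by
    rw [← hr]; exact_mod_cast Rat.den_mul_eq_num r
  have half_lt : 1 / (2 * (r.den : ℝ)) < 1 / r.den := by
    gcongr; linarith
  have le_one : 1 / (r.den : ℝ) ≤ 1 := (div_le_one den_pos).2 one_le_den
  obtain ⟨N, ⟨v, hv₀, hv₁⟩, w, hw₀, hw₁⟩ :=
    ((eventually_exists_fract_mem_Ioc h le_rfl (by positivity) (half_lt.le.trans le_one)).and
      (eventually_exists_fract_mem_Ioc h (by positivity) half_lt le_one)).exists
  have diff_pos := sub_pos.2 (hv₁.trans_lt hw₀)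
  have diff_lt : _ - _ < 1 / (r.den : ℝ) := (sub_lt_self _ hv₀).trans_le hw₁
  have diff_int : ∃ k : ℤ, (r.den : ℝ) * (Int.fract (c + ∑ j, b (w j))
      - Int.fract (c + ∑ j, b (v j))) = k := by
    refine ⟨((∑ j, (w j : ℕ) : ℕ) - (∑ j, (v j : ℕ) : ℕ)) * r.num
      - r.den * (⌊c + ∑ j, b (w j)⌋ - ⌊c + ∑ j, b (v j)⌋), ?_⟩
    rw [Int.fract, Int.fract, Int.cast_sub, Int.cast_mul, ← hmul]
    generalize ⌊c + ∑ j, b (w j)⌋ = e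
    generalize ⌊c + ∑ j, b (v j)⌋ = f
    rw [sum_eq_mul_add_card_mul b w, sum_eq_mul_add_card_mul b v]
    push_cast
    ring
  obtain ⟨k, hk⟩ := diff_int
  have k_pos : 0 < k := by
    have := mul_pos den_pos diff_pos
    rw [hk] at this
    exact_mod_cast this
  have k_lt : k < 1 := by
    rw [lt_div_iff₀' den_pos, hk] at diff_lt
    exact_mod_cast diff_lt
  lia

/-- Fixed single proportion stick fragmentation theorem (`m = 2`): with
proportion `p ∈ (0,1)` and initial length `L > 0`, each stick after `N` stages
corresponds to a word `w : Fin N → Fin 2` and has length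
`L * ∏ j, (![p, 1-p]) (w j) = L * p^{#{j : w j = 0}} * (1-p)^{#{j : w j = 1}}`.
If `y` satisfies `10^y = (1-p)/p`, then the stick lengths converge to strong
Benford's law base 10 if and only if `y` is irrational. -/
theorem singleProportion_strongBenford_iff (p : ℝ) (hp : p ∈ Set.Ioo (0 : ℝ) 1)
    (L : ℝ) (hL : 0 < L) (y : ℝ) (hy : (10 : ℝ) ^ y = (1 - p) / p) :
    StrongBenfordSticks 2 ![p, 1 - p] L ↔ Irrational y := by
  obtain ⟨hp₀, hp₁⟩ := hp
  have hq (i : Fin 2) : 0 < (![p, 1 - p] : Fin 2 → ℝ) i := by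
    fin_cases i
    · simpa using hp₀
    · simpa using hp₁
  set b : Fin 2 → ℝ := fun i => Real.logb 10 ((![p, 1 - p] : Fin 2 → ℝ) i) with hb
  have y_eq : b 1 - b 0 = y := by
    rw [← Real.logb_rpow (b := 10) (x := y) (by norm_num) (by norm_num), hy,
      Real.logb_div (sub_pos.2 hp₁).ne' hp₀.ne']
    simp [hb]
  rw [strongBenfordSticks_iff hq hL, ← y_eq]
  exact ⟨irrational_of_tendsto_card_fract_le (b := b),
    fun h t ht => by simpa using tendsto_card_fract_le h (Real.logb 10 L) ht.1 ht.2⟩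
end

section
/- Let m ≥ 2, let p_1, …, p_m be positive real numbers, and suppose that for each 1 ≤ i ≤ m−1 there are integers a_i and positive integers b_i with log_{10}(p_i/p_{i+1}) = a_i/b_i. Then for every N, the set of fractional parts { log_{10}(p_1^{k_1}·⋯·p_m^{k_m}) mod 1 : k_1,…,k_m nonnegative integers with k_1+⋯+k_m = N } has cardinality at most ∏_{i=1}^{m-1} b_i; in particular this bound is independent of N. -/
/-- If consecutive differences of `L` are integer multiples of `1 / D`, so are the differences
with its last term. -/
theorem exists_int_mul_sub_last {n : ℕ} {L : Fin (n + 1) → ℝ} {D : ℝ}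
    (h : ∀ i : Fin n, ∃ z : ℤ, D * (L i.castSucc - L i.succ) = z) (i : Fin (n + 1)) :
    ∃ z : ℤ, D * (L i - L (Fin.last n)) = z := by
  induction i using Fin.reverseInduction with
  | last => exact ⟨0, by simp⟩
  | cast i ih =>
    obtain ⟨y, hy⟩ := h i
    obtain ⟨z, hz⟩ := ih
    exact ⟨y + z, by push_cast; linear_combination hy + hz⟩

/-- The fractional parts of `c + Z / D` for `Z ∈ ℤ` are attained at `0 ≤ Z < D`. -/
theorem exists_lt_fract_add_div {D : ℕ} (hD : 0 < D) (c : ℝ) (Z : ℤ) :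
    ∃ r < D, Int.fract (c + (r : ℝ) / D) = Int.fract (c + (Z : ℝ) / D) := by
  have hD' : (D : ℤ) ≠ 0 := by positivity
  have hDR : (D : ℝ) ≠ 0 := by positivity
  have hr : ((Z % D).toNat : ℤ) = Z % D := Int.toNat_of_nonneg (Int.emod_nonneg Z hD')
  have hlt : Z % D < D := Int.emod_lt_of_pos Z (by positivity)
  refine ⟨(Z % D).toNat, by omega, ?_⟩
  have hZ : (Z : ℝ) = ((Z % D).toNat : ℝ) + D * (Z / D : ℤ) := by
    have := Int.emod_add_mul_ediv Z D
    rw [← hr] at this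
    exact_mod_cast this.symm
  have hsum : c + (Z : ℝ) / D = c + ((Z % D).toNat : ℝ) / D + (Z / D : ℤ) := by
    rw [hZ]
    field_simp
    ring
  rw [hsum, Int.fract_add_intCast]


/-- For `m = n + 1 ≥ 2` positive reals `p₁, …, p_m` such that each ratio
`log₁₀ (pᵢ/pᵢ₊₁)` equals `aᵢ/bᵢ` with `aᵢ ∈ ℤ` and `bᵢ ∈ ℤ_{>0}`, and every `N`,
the set of fractional parts `{log₁₀ (p₁^{k₁} ⋯ p_m^{k_m}) mod 1 :
k₁, …, k_m ∈ ℕ, k₁ + ⋯ + k_m = N}` has cardinality at most `∏_{i=1}^{m-1} bᵢ`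
(a bound independent of `N`). -/
theorem card_fract_log_le (n : ℕ) (hn : 1 ≤ n)
    (p : Fin (n + 1) → ℝ) (hp : ∀ i, 0 < p i)
    (a : Fin n → ℤ) (b : Fin n → ℕ) (hb : ∀ i, 0 < b i)
    (hlog : ∀ i : Fin n,
      Real.logb 10 (p i.castSucc / p i.succ) = (a i : ℝ) / (b i : ℝ))
    (N : ℕ) :
    Nat.card {x : ℝ | ∃ k : Fin (n + 1) → ℕ, ∑ i, k i = N ∧
        x = Int.fract (Real.logb 10 (∏ i, p i ^ k i))} ≤ ∏ i, b i := by
  have hD : 0 < ∏ i, b i := Finset.prod_pos fun i _ => hb i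
  have hDR : ((∏ i, b i : ℕ) : ℝ) ≠ 0 := by exact_mod_cast hD.ne'
  have hstep (i : Fin n) : ∃ z : ℤ, ((∏ i, b i : ℕ) : ℝ) *
      (Real.logb 10 (p i.castSucc) - Real.logb 10 (p i.succ)) = z := by
    obtain ⟨e, he⟩ := Finset.dvd_prod_of_mem b (Finset.mem_univ i)
    have hbi : (b i : ℝ) ≠ 0 := by exact_mod_cast (hb i).ne'
    refine ⟨e * a i, ?_⟩
    rw [← Real.logb_div (hp _).ne' (hp _).ne', hlog, he]
    push_cast
    field_simp
  choose z hz using exists_int_mul_sub_last (L := fun i => Real.logb 10 (p i)) hstep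
  generalize ∏ i, b i = D at *
  let f (r : ℕ) : ℝ := Int.fract (N * Real.logb 10 (p (Fin.last n)) + (r : ℝ) / D)
  calc Nat.card _ ≤ Nat.card ((Finset.range D).image f : Set ℝ) := by
        refine Nat.card_mono (Finset.finite_toSet _) ?_
        rintro x ⟨k, hk, rfl⟩
        have hsum : Real.logb 10 (∏ i, p i ^ k i) =
            N * Real.logb 10 (p (Fin.last n)) + ((∑ i, k i * z i : ℤ) : ℝ) / D := by
          rw [Real.logb_prod _ _ fun i _ => (pow_pos (hp i) _).ne', ← hk]
          push_cast
          rw [Finset.sum_mul, Finset.sum_div, ← Finset.sum_add_distrib]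
          refine Finset.sum_congr rfl fun i _ => ?_
          rw [Real.logb_pow, ← hz i]
          field_simp
          ring
        obtain ⟨r, hr, hfr⟩ := exists_lt_fract_add_div hD
          (N * Real.logb 10 (p (Fin.last n))) (∑ i, k i * z i)
        rw [hsum, ← hfr]
        exact Finset.mem_coe.2 (Finset.mem_image_of_mem f (Finset.mem_range.2 hr))
    _ = ((Finset.range D).image f).card := Nat.card_eq_card_toFinset _ |>.trans (by rw [Finset.toFinset_coe])
    _ ≤ D := Finset.card_image_le.trans_eq (Finset.card_range D)
end
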